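/- For D > 2, every t ≥ 0, and every coordinate i ∈ {1,…,d}, the linear predictor w(t) implemented by the gradient-flow trajectory satisfies d/dt wᵢ(t) = α^{2D−2} D(D−2) · h_D′( h_D^{−1}( wᵢ(t)/α^D ) ) · [X r(t)]ᵢ, where h_D′ denotes the derivative of h_D. -/

import Mathlib

open Real Finset Filter Topology MeasureTheory

/-- A solution of the linear equation `u' = a u` with continuous coefficient stays positive. -/
theorem pos_of_hasDerivAt_mul {u a : ℝ → ℝ} (ha : ContinuousOn a (Set.Ici 0))
    (hu : ∀ t, 0 ≤ t → HasDerivAt u (a t * u t) t) (h0 : 0 < u 0) :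
    ∀ t, 0 ≤ t → 0 < u t := by
  intro T hT
  obtain ⟨K, hK⟩ := (isCompact_Icc (a := (0 : ℝ)) (b := T)).exists_bound_of_continuousOn
    (ha.mono Set.Icc_subset_Ici_self)
  have hder : ∀ t ∈ Set.Icc 0 T, HasDerivAt (fun s => (u s) ^ 2 * Real.exp (2 * K * s))
      (2 * (a t + K) * ((u t) ^ 2 * Real.exp (2 * K * t))) t := by
    intro t ht
    have h := ((hu t ht.1).pow 2).mul (((hasDerivAt_id t).const_mul (2 * K)).exp)
    refine h.congr_deriv ?_
    simp only [id, Pi.pow_apply]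
    push_cast
    ring
  have hmono : MonotoneOn (fun s => (u s) ^ 2 * Real.exp (2 * K * s)) (Set.Icc 0 T) := by
    refine monotoneOn_of_deriv_nonneg (convex_Icc 0 T)
      (fun t ht => (hder t ht).continuousAt.continuousWithinAt)
      (fun t ht => (hder t (interior_subset ht)).differentiableAt.differentiableWithinAt) ?_
    intro t ht
    rw [(hder t (interior_subset ht)).deriv]
    have := (abs_le.mp (hK t (interior_subset ht))).1
    have : 0 ≤ a t + K := by linarith
    positivity
  have hne : ∀ t ∈ Set.Icc 0 T, u t ≠ 0 := by
    intro t ht h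
    have := hmono (Set.left_mem_Icc.mpr hT) ht ht.1
    simp only [h, mul_zero, Real.exp_zero, mul_one] at this
    nlinarith
  by_contra! hneg
  obtain ⟨c, hc, hc0⟩ := intermediate_value_Icc' hT
    (fun t ht => (hu t ht.1).continuousAt.continuousWithinAt) (show (0 : ℝ) ∈ Set.Icc (u T) (u 0)
      from ⟨hneg, h0.le⟩)
  exact hne c hc hc0

/-- The conserved quantity of the opposite power flows `u' = g u ^ (k + 1)`,
`v' = -g v ^ (k + 1)`. -/
theorem inv_pow_add_inv_pow_eq {k : ℕ} {u v g : ℝ → ℝ}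
    (hu : ∀ t, 0 ≤ t → HasDerivAt u (g t * u t ^ (k + 1)) t)
    (hv : ∀ t, 0 ≤ t → HasDerivAt v (-(g t * v t ^ (k + 1))) t)
    (hupos : ∀ t, 0 ≤ t → 0 < u t) (hvpos : ∀ t, 0 ≤ t → 0 < v t) {t : ℝ} (ht : 0 ≤ t) :
    (u t ^ k)⁻¹ + (v t ^ k)⁻¹ = (u 0 ^ k)⁻¹ + (v 0 ^ k)⁻¹ := by
  have key : ∀ {y : ℝ → ℝ} {c s : ℝ}, HasDerivAt y (c * y s ^ (k + 1)) s → 0 < y s →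
      HasDerivAt (fun s => (y s ^ k)⁻¹) (-(k * c)) s := by
    intro y c s hy hpos
    refine ((hy.pow k).inv (pow_pos hpos k).ne').congr_deriv ?_
    rcases k with _ | k
    · simp
    · simp only [Pi.pow_apply, Nat.add_sub_cancel]
      field_simp
      ring
  have hder : ∀ s ∈ Set.Icc 0 t,
      HasDerivAt (fun s => (u s ^ k)⁻¹ + (v s ^ k)⁻¹) 0 s := by
    intro s hs
    have hv' : HasDerivAt v (-g s * v s ^ (k + 1)) s := by
      simpa only [neg_mul] using hv s hs.1
    exact ((key (hu s hs.1) (hupos s hs.1)).add (key hv' (hvpos s hs.1))).congr_deriv (by ring)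
  exact constant_of_has_deriv_right_zero
    (fun s hs => (hder s hs).continuousAt.continuousWithinAt)
    (fun s hs => (hder s ⟨hs.1, hs.2.le⟩).hasDerivWithinAt) t (Set.right_mem_Icc.mpr ht)

theorem strictMonoOn_one_sub_rpow_sub_one_add_rpow {p : ℝ} (hp : p < 0) :
    StrictMonoOn (fun z : ℝ => (1 - z) ^ p - (1 + z) ^ p) (Set.Ioo (-1) 1) := by
  intro a ha b hb hab
  have h1 : (1 - a) ^ p < (1 - b) ^ p :=
    Real.rpow_lt_rpow_of_neg (by linarith [hb.2]) (by linarith) hp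
  have h2 : (1 + b) ^ p < (1 + a) ^ p :=
    Real.rpow_lt_rpow_of_neg (by linarith [ha.1]) (by linarith) hp
  simp only
  linarith

theorem hasDerivAt_one_sub_rpow_sub_one_add_rpow {p z : ℝ} (hz : z ∈ Set.Ioo (-1 : ℝ) 1) :
    HasDerivAt (fun z : ℝ => (1 - z) ^ p - (1 + z) ^ p)
      (-p * ((1 - z) ^ (p - 1) + (1 + z) ^ (p - 1))) z := by
  have h1 := ((hasDerivAt_id z).const_sub 1).rpow_const (p := p)
    (Or.inl (by simp only [id]; linarith [hz.2]))
  have h2 := ((hasDerivAt_id z).const_add 1).rpow_const (p := p)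
    (Or.inl (by simp only [id]; linarith [hz.1]))
  refine (h1.sub h2).congr_deriv ?_
  simp only [id]
  ring

theorem div_pow_rpow_eq {k m : ℕ} {a u q : ℝ} (ha : 0 < a) (hu : 0 < u) (hq : k * q = -m) :
    ((a / u) ^ k) ^ q = u ^ m / a ^ m := by
  have h : 0 < a / u := div_pos ha hu
  rw [← Real.rpow_natCast, ← Real.rpow_mul h.le, hq, Real.rpow_neg h.le, Real.rpow_natCast,
    div_pow, inv_div]

theorem stmt5
    (d N D : ℕ) (hd : 0 < d) (hN : 0 < N) (hD : 2 < D)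
    (x : Fin N → Fin d → ℝ)
    (γ₂ : ℝ) (hγ₂pos : 0 < γ₂)
    (hγ₂ : IsGreatest {g : ℝ | ∃ v : Fin d → ℝ, (∑ i, (v i)^2) = 1 ∧ ∀ n, g ≤ ∑ i, x n i * v i} γ₂)
    (α : ℝ) (hα : 0 < α)
    (up um : ℝ → Fin d → ℝ)
    (hinit : ∀ i, up 0 i = α ∧ um 0 i = α)
    (w : ℝ → Fin d → ℝ)
    (hw : ∀ t i, w t i = (up t i)^D - (um t i)^D)
    (hflowp : ∀ t, 0 ≤ t → ∀ i, HasDerivAt (fun s => up s i)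
        (((D:ℝ)/(N:ℝ)) * (up t i)^(D-1) * ∑ n, Real.exp (-(∑ j, x n j * w t j)) * x n i) t)
    (hflowm : ∀ t, 0 ≤ t → ∀ i, HasDerivAt (fun s => um s i)
        (-(((D:ℝ)/(N:ℝ)) * (um t i)^(D-1) * ∑ n, Real.exp (-(∑ j, x n j * w t j)) * x n i)) t)
    (r : ℝ → Fin N → ℝ)
    (hr : ∀ t n, r t n = (1 / (N:ℝ)) * Real.exp (-(∑ i, x n i * w t i)))
    (hinv : ℝ → ℝ)
    (hinv_mem : ∀ y : ℝ, -1 < hinv y ∧ hinv y < 1)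
    (hinv_eq : ∀ y : ℝ,
        (1 - hinv y) ^ (-(D:ℝ)/((D:ℝ)-2)) - (1 + hinv y) ^ (-(D:ℝ)/((D:ℝ)-2)) = y)
    (h' : ℝ → ℝ)
    (hh' : ∀ z : ℝ, -1 < z → z < 1 → HasDerivAt
        (fun y => (1 - y) ^ (-(D:ℝ)/((D:ℝ)-2)) - (1 + y) ^ (-(D:ℝ)/((D:ℝ)-2))) (h' z) z)
    :
    ∀ t : ℝ, 0 ≤ t → ∀ i : Fin d,
      HasDerivAt (fun s => w s i)
        (α^(2*D-2) * (D:ℝ) * ((D:ℝ)-2) * h' (hinv (w t i / α^D)) * ∑ n, r t n * x n i) t := by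
  obtain ⟨k, rfl⟩ : ∃ k, D = k + 2 := ⟨D - 2, by omega⟩
  have hk : (0 : ℝ) < k := by exact_mod_cast (by omega : 0 < k)
  have hcast : ((k + 2 : ℕ) : ℝ) = k + 2 := by push_cast; ring
  intro t ht i
  set g : ℝ → ℝ := fun s => (k + 2) * ∑ n, r s n * x n i with hg
  have hsum : ∀ s, g s = (k + 2) / N * ∑ n, Real.exp (-(∑ j, x n j * w s j)) * x n i := by
    intro s
    simp only [hg, hr, Finset.mul_sum]
    exact Finset.sum_congr rfl fun n _ => by ring
  have hup : ∀ s, 0 ≤ s → HasDerivAt (fun s => up s i) (g s * up s i ^ (k + 1)) s := by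
    intro s hs
    refine (hflowp s hs i).congr_deriv ?_
    rw [hsum, hcast, show k + 2 - 1 = k + 1 by omega]
    ring
  have hum : ∀ s, 0 ≤ s → HasDerivAt (fun s => um s i) (-(g s * um s i ^ (k + 1))) s := by
    intro s hs
    refine (hflowm s hs i).congr_deriv ?_
    rw [hsum, hcast, show k + 2 - 1 = k + 1 by omega]
    ring
  have hupc : ∀ j, ContinuousOn (fun s => up s j) (Set.Ici 0) := fun j s hs =>
    (hflowp s hs j).continuousAt.continuousWithinAt
  have humc : ∀ j, ContinuousOn (fun s => um s j) (Set.Ici 0) := fun j s hs =>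
    (hflowm s hs j).continuousAt.continuousWithinAt
  have hgc : ContinuousOn g (Set.Ici 0) := by
    have hwc : ∀ j, ContinuousOn (fun s => w s j) (Set.Ici 0) := by
      intro j
      simp only [hw]
      exact ((hupc j).pow _).sub ((humc j).pow _)
    simp only [hg, hr]
    fun_prop
  have hppos : ∀ s, 0 ≤ s → 0 < up s i := by
    refine pos_of_hasDerivAt_mul (u := fun s => up s i) (hgc.mul ((hupc i).pow k))
      (fun s hs => (hup s hs).congr_deriv ?_) (by simpa [(hinit i).1] using hα)
    simp only [Pi.mul_apply, Pi.pow_apply]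
    ring
  have hmpos : ∀ s, 0 ≤ s → 0 < um s i := by
    refine pos_of_hasDerivAt_mul (u := fun s => um s i) (hgc.mul ((humc i).pow k)).neg
      (fun s hs => (hum s hs).congr_deriv ?_) (by simpa [(hinit i).2] using hα)
    simp only [Pi.neg_apply, Pi.mul_apply, Pi.pow_apply]
    ring
  have hP := hppos t ht
  have hM := hmpos t ht
  have hcons : (α / up t i) ^ k + (α / um t i) ^ k = 2 := by
    have h := inv_pow_add_inv_pow_eq hup hum hppos hmpos ht
    simp only [(hinit i).1, (hinit i).2] at h
    rw [div_pow, div_pow, div_eq_mul_inv, div_eq_mul_inv, ← mul_add, h]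
    field_simp
    norm_num
  have hpos1 : 0 < (α / up t i) ^ k := by positivity
  have hpos2 : 0 < (α / um t i) ^ k := by positivity
  obtain ⟨z, hz⟩ : ∃ z, z = 1 - (α / up t i) ^ k := ⟨_, rfl⟩
  have hz1 : 1 - z = (α / up t i) ^ k := by linarith
  have hz2 : 1 + z = (α / um t i) ^ k := by linarith
  have hzmem : z ∈ Set.Ioo (-1 : ℝ) 1 := ⟨by linarith, by linarith⟩
  obtain ⟨p, hp⟩ : ∃ p : ℝ, p = -((k + 2 : ℕ) : ℝ) / (((k + 2 : ℕ) : ℝ) - 2) := ⟨_, rfl⟩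
  rw [← hp] at hinv_eq hh'
  have hkp : k * p = -((k + 2 : ℕ) : ℝ) := by
    rw [hp, hcast, add_sub_cancel_right]
    field_simp
  have hp0 : p < 0 := by
    rw [hcast] at hkp
    by_contra! h
    nlinarith
  have hkp' : k * (p - 1) = -((2 * k + 2 : ℕ) : ℝ) := by
    rw [mul_sub, hkp]
    push_cast
    ring
  have hinvz : hinv (w t i / α ^ (k + 2)) = z := by
    refine (strictMonoOn_one_sub_rpow_sub_one_add_rpow hp0).injOn (hinv_mem _) hzmem ?_
    simp only [hinv_eq]
    rw [hz1, hz2, div_pow_rpow_eq hα hP hkp, div_pow_rpow_eq hα hM hkp, hw, sub_div]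
  have hh'z : k * h' z =
      (k + 2) * (up t i ^ (2 * k + 2) + um t i ^ (2 * k + 2)) / α ^ (2 * k + 2) := by
    rw [(hh' z hzmem.1 hzmem.2).unique (hasDerivAt_one_sub_rpow_sub_one_add_rpow hzmem), hz1, hz2,
      div_pow_rpow_eq hα hP hkp', div_pow_rpow_eq hα hM hkp', ← mul_assoc, mul_neg, hkp, hcast]
    ring
  have hwder := ((hup t ht).pow (k + 2)).sub ((hum t ht).pow (k + 2))
  have hwfun : (fun s => w s i) = (fun s => up s i) ^ (k + 2) - (fun s => um s i) ^ (k + 2) := by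
    funext s
    exact hw s i
  rw [hwfun]
  refine hwder.congr_deriv ?_
  rw [hinvz, hcast, show 2 * (k + 2) - 2 = 2 * k + 2 by omega, show k + 2 - 1 = k + 1 by omega,
    show ∀ S : ℝ, α ^ (2 * k + 2) * (k + 2 : ℝ) * (k + 2 - 2) * h' z * S =
      α ^ (2 * k + 2) * (k + 2) * (k * h' z) * S from fun S => by ring, hh'z]
  simp only [hg]
  field_simp
  ring
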